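/- arXiv:2508.07156 — 5 statements merged into one kernel-verified Lean document; each statement's English description precedes it below -/
import Mathlib

section
/- Let φ ∈ L[X] be a nonconstant polynomial. Then the Gauss point is fixed by φ, i.e. ζ_G(P ∘ φ) = ζ_G(P) for every P ∈ L[X], if and only if all coefficients of φ lie in O_L and the reduction φ̃ ∈ k[X] (obtained by reducing each coefficient modulo m_L) is a nonconstant polynomial. -/
open Polynomial

/-- The Gauss norm of a polynomial: the supremum (maximum) of the absolute values of its
coefficients.  The Gauss point `ζ_G` of the Berkovich affine line is the multiplicative
seminorm `P ↦ gaussNorm P`. -/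
noncomputable def gaussNorm {L : Type*} [NontriviallyNormedField L] (P : Polynomial L) : ℝ :=
  ⨆ i : ℕ, ‖P.coeff i‖

/-- The supremum defining the Gauss norm agrees with the Gauss norm of Mathlib at radius `1`. -/
theorem gaussNorm_eq_polynomial_gaussNorm {L : Type*} [NontriviallyNormedField L] (P : L[X]) :
    _root_.gaussNorm P = Polynomial.gaussNorm (NormedField.toAbsoluteValue L) 1 P := by
  obtain ⟨i, hi⟩ := Polynomial.exists_eq_gaussNorm (NormedField.toAbsoluteValue L) 1 P
  have hle (j : ℕ) : ‖P.coeff j‖ ≤ Polynomial.gaussNorm (NormedField.toAbsoluteValue L) 1 P := by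
    simpa using! Polynomial.le_gaussNorm (NormedField.toAbsoluteValue L) P zero_le_one j
  refine le_antisymm (ciSup_le hle) ?_
  rw [hi, one_pow, mul_one]
  exact le_ciSup (f := fun j ↦ ‖P.coeff j‖) ⟨_, Set.forall_mem_range.2 hle⟩ i

theorem norm_coeff_le_gaussNorm {L : Type*} [NontriviallyNormedField L] (P : L[X]) (i : ℕ) :
    ‖P.coeff i‖ ≤ _root_.gaussNorm P := by
  rw [gaussNorm_eq_polynomial_gaussNorm]
  simpa using! Polynomial.le_gaussNorm (NormedField.toAbsoluteValue L) P zero_le_one i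

theorem exists_gaussNorm_eq_norm_coeff {L : Type*} [NontriviallyNormedField L] (P : L[X]) :
    ∃ i, _root_.gaussNorm P = ‖P.coeff i‖ := by
  rw [gaussNorm_eq_polynomial_gaussNorm]
  simpa using! Polynomial.exists_eq_gaussNorm (NormedField.toAbsoluteValue L) 1 P

theorem gaussNorm_C_eq_norm {L : Type*} [NontriviallyNormedField L] (a : L) :
    _root_.gaussNorm (C a) = ‖a‖ := by
  rw [gaussNorm_eq_polynomial_gaussNorm, Polynomial.gaussNorm_C]
  rfl

/-- Gauss's lemma: the Gauss norm of a nonarchimedean field is multiplicative. -/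
theorem gaussNorm_mul_of_isNonarchimedean {L : Type*} [NontriviallyNormedField L]
    (hna : IsNonarchimedean (fun x : L => ‖x‖)) (P Q : L[X]) :
    _root_.gaussNorm (P * Q) = _root_.gaussNorm P * _root_.gaussNorm Q := by
  simp only [gaussNorm_eq_polynomial_gaussNorm]
  have hv : IsNonarchimedean (NormedField.toAbsoluteValue L) := hna
  exact Polynomial.gaussNorm_mul hv one_pos P Q

/-- If `ψ` has integral coefficients, one of which is a unit in positive degree, then translating
`ψ` by a constant `a` gives a polynomial of Gauss norm `max 1 ‖a‖`. -/
theorem gaussNorm_sub_C {L : Type*} [NontriviallyNormedField L]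
    (hna : IsNonarchimedean (fun x : L => ‖x‖)) {ψ : L[X]} (hψ : ∀ i, ‖ψ.coeff i‖ ≤ 1)
    {i : ℕ} (hi : 1 ≤ i) (hψi : ‖ψ.coeff i‖ = 1) (a : L) :
    _root_.gaussNorm (ψ - C a) = max 1 ‖a‖ := by
  have hcoeff {j : ℕ} (hj : j ≠ 0) : (ψ - C a).coeff j = ψ.coeff j := by
    simp [coeff_C, hj]
  have hcoeff_zero : (ψ - C a).coeff 0 = ψ.coeff 0 - a := by simp
  have hsub (x y : L) : ‖x - y‖ ≤ max ‖x‖ ‖y‖ := by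
    simpa [sub_eq_add_neg] using hna x (-y)
  have hone : 1 ≤ _root_.gaussNorm (ψ - C a) := by
    simpa only [hcoeff (Nat.one_le_iff_ne_zero.1 hi), hψi] using
      norm_coeff_le_gaussNorm (ψ - C a) i
  refine le_antisymm (ciSup_le fun j ↦ ?_) (max_le hone ?_)
  · rcases eq_or_ne j 0 with rfl | hj
    · rw [hcoeff_zero]
      exact (hsub _ _).trans (max_le_max_right _ (hψ 0))
    · rw [hcoeff hj]
      exact (hψ j).trans (le_max_left _ _)
  · have hzero := norm_coeff_le_gaussNorm (ψ - C a) 0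
    rw [hcoeff_zero] at hzero
    have ha := hsub (ψ.coeff 0) (ψ.coeff 0 - a)
    rw [sub_sub_cancel] at ha
    exact ha.trans (max_le ((hψ 0).trans hone) hzero)

/-- A polynomial map preserving the Gauss norms of all `X - C a` preserves all Gauss norms. -/
theorem gaussNorm_comp_eq_of_forall_sub_C {L : Type*} [NontriviallyNormedField L] [IsAlgClosed L]
    (hna : IsNonarchimedean (fun x : L => ‖x‖)) {φ : L[X]}
    (h : ∀ a : L, _root_.gaussNorm (φ - C a) = _root_.gaussNorm (X - C a : L[X])) (P : L[X]) :
    _root_.gaussNorm (P.comp φ) = _root_.gaussNorm P := by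
  have hroots (s : Multiset L) : _root_.gaussNorm ((s.map fun a ↦ X - C a).prod.comp φ) =
      _root_.gaussNorm (s.map fun a ↦ X - C a).prod := by
    induction s using Multiset.induction with
    | empty => simp
    | cons a s ih =>
      simp only [Multiset.map_cons, Multiset.prod_cons, mul_comp, sub_comp, X_comp, C_comp,
        gaussNorm_mul_of_isNonarchimedean hna, ih, h]
  rw [(IsAlgClosed.splits P).eq_prod_roots, mul_comp, C_comp,
    gaussNorm_mul_of_isNonarchimedean hna, gaussNorm_mul_of_isNonarchimedean hna, hroots]

/-- Let `φ ∈ L[X]` be a nonconstant polynomial.  The Gauss point is fixed by `φ`, i.e.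
`ζ_G(P ∘ φ) = ζ_G(P)` for every `P ∈ L[X]`, if and only if all coefficients of `φ` lie in
`O_L` and the reduction `φ̃ ∈ k[X]` is a nonconstant polynomial (equivalently, some
coefficient of `φ` of index `≥ 1` has absolute value `1`). -/
theorem gauss_point_fixed_iff_nonconstant_reduction
    (L : Type*) [NontriviallyNormedField L] [CompleteSpace L] [IsAlgClosed L] [CharZero L]
    (hna : IsNonarchimedean (fun x : L => ‖x‖))
    (φ : L[X]) (hφ : 0 < φ.natDegree) :
    (∀ P : L[X], gaussNorm (P.comp φ) = gaussNorm P) ↔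
      ((∀ i, ‖φ.coeff i‖ ≤ 1) ∧ ∃ i, 1 ≤ i ∧ ‖φ.coeff i‖ = 1) := by
  have hX (i : ℕ) : ‖(X : L[X]).coeff i‖ ≤ 1 := by
    rw [coeff_X]
    split_ifs <;> simp
  have hX_sub (a : L) : _root_.gaussNorm (X - C a : L[X]) = max 1 ‖a‖ :=
    gaussNorm_sub_C hna hX le_rfl (by simp) a
  constructor
  · intro h
    have hφ_norm : _root_.gaussNorm φ = 1 := by
      simpa using (h X).trans (by simpa using hX_sub 0)
    have hle (i : ℕ) : ‖φ.coeff i‖ ≤ 1 := hφ_norm ▸ norm_coeff_le_gaussNorm φ i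
    refine ⟨hle, ?_⟩
    have hsub : _root_.gaussNorm (φ - C (φ.coeff 0)) = 1 := by
      have hcomp := h (X - C (φ.coeff 0))
      rwa [sub_comp, X_comp, C_comp, hX_sub, max_eq_left (hle 0)] at hcomp
    obtain ⟨i, hi⟩ := exists_gaussNorm_eq_norm_coeff (φ - C (φ.coeff 0))
    rw [hsub] at hi
    rcases eq_or_ne i 0 with rfl | hi0
    · simp at hi
    · exact ⟨i, Nat.one_le_iff_ne_zero.2 hi0, by simpa [coeff_C, hi0] using hi.symm⟩
  · rintro ⟨hle, i, hi, hφi⟩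
    exact gaussNorm_comp_eq_of_forall_sub_C hna fun a ↦
      (gaussNorm_sub_C hna hle hi hφi a).trans (hX_sub a).symm
end

section
/- (Polynomial case of the uniqueness of the totally ramified fixed point, Lemma 3.5.) Let φ ∈ O_L[X] be a polynomial of degree d ≥ 2 with good reduction, and let a, b ∈ L with a ≠ 0. If the conjugated polynomial ψ(X) := a⁻¹·(φ(aX + b) − b) also has all its coefficients in O_L and leading coefficient of absolute value 1 (i.e. ψ also has good reduction), then ‖a‖ = 1 and ‖b‖ ≤ 1. -/
open Polynomial

/-- Off the closed unit disc, a polynomial with coefficients of norm at most `1` is dominated by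
its leading term. -/
theorem norm_eval_sub_leadingTerm_le {L : Type*} [NormedField L] [IsUltrametricDist L]
    (p : L[X]) (hcoeff : ∀ i, ‖p.coeff i‖ ≤ 1) (x : L) (hx : 1 ≤ ‖x‖) :
    ‖p.eval x - p.leadingCoeff * x ^ p.natDegree‖ ≤ ‖x‖ ^ (p.natDegree - 1) := by
  rw [eval_eq_sum_range, Finset.sum_range_succ, leadingCoeff, add_sub_cancel_right]
  refine IsUltrametricDist.norm_sum_le_of_forall_le_of_nonneg (by positivity) fun i hi => ?_
  rw [norm_mul, norm_pow]
  have hi' : i ≤ p.natDegree - 1 := Nat.le_sub_one_of_lt (Finset.mem_range.mp hi)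
  calc ‖p.coeff i‖ * ‖x‖ ^ i ≤ 1 * ‖x‖ ^ (p.natDegree - 1) := by
        gcongr
        · exact hcoeff i
    _ = _ := one_mul _

/-- The leading coefficient of the affine conjugate of a polynomial of degree at least `2`. -/
theorem leadingCoeff_affine_conjugate {K : Type*} [Field K] (p : K[X]) (hp : 2 ≤ p.natDegree)
    (a b : K) (ha : a ≠ 0) :
    (C a⁻¹ * (p.comp (C a * X + C b) - C b)).leadingCoeff =
      p.leadingCoeff * a ^ (p.natDegree - 1) := by
  have hlin : (C a * X + C b).natDegree = 1 := natDegree_linear ha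
  have hnat : (p.comp (C a * X + C b)).natDegree = p.natDegree := by
    rw [natDegree_comp, hlin, mul_one]
  have hdeg : (C b).degree < (p.comp (C a * X + C b)).degree := by
    refine degree_lt_degree ?_
    rw [hnat, natDegree_C]
    omega
  rw [leadingCoeff_mul, leadingCoeff_C, leadingCoeff_sub_of_degree_lt hdeg,
    leadingCoeff_comp (by rw [hlin]; exact one_ne_zero), leadingCoeff_linear ha]
  obtain ⟨n, hn⟩ : ∃ n, p.natDegree = n + 1 := ⟨p.natDegree - 1, by omega⟩
  rw [hn, Nat.add_sub_cancel, pow_succ]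
  field_simp

/-- Polynomial case of the uniqueness of the totally ramified fixed point (Lemma 3.5):
if `φ ∈ O_L[X]` has degree `d ≥ 2` and good reduction, and the conjugate
`ψ(X) = a⁻¹·(φ(aX + b) − b)` also has all coefficients in `O_L` with leading coefficient
of absolute value `1`, then `‖a‖ = 1` and `‖b‖ ≤ 1`. -/
theorem conjugate_good_reduction_norm_eq_one
    (L : Type*) [NontriviallyNormedField L] [CompleteSpace L] [IsAlgClosed L] [CharZero L]
    (hna : IsNonarchimedean (fun x : L => ‖x‖))
    (φ : L[X]) (d : ℕ) (hd : 2 ≤ d) (hdeg : φ.natDegree = d)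
    (hcoeff : ∀ i, ‖φ.coeff i‖ ≤ 1) (hlead : ‖φ.leadingCoeff‖ = 1)
    (a b : L) (ha : a ≠ 0)
    (hψcoeff : ∀ i, ‖(C a⁻¹ * (φ.comp (C a * X + C b) - C b)).coeff i‖ ≤ 1)
    (hψlead : ‖(C a⁻¹ * (φ.comp (C a * X + C b) - C b)).leadingCoeff‖ = 1) :
    ‖a‖ = 1 ∧ ‖b‖ ≤ 1 := by
  have : IsUltrametricDist L := IsUltrametricDist.isUltrametricDist_of_isNonarchimedean_norm hna
  subst hdeg
  have hnorm_a : ‖a‖ = 1 := by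
    rw [leadingCoeff_affine_conjugate φ hd a b ha, norm_mul, hlead, one_mul, norm_pow] at hψlead
    exact (pow_eq_one_iff_of_nonneg (norm_nonneg a) (by omega)).mp hψlead
  refine ⟨hnorm_a, ?_⟩
  by_contra! hb
  have hconst : ‖φ.eval b - b‖ ≤ 1 := by
    have h := hψcoeff 0
    rw [coeff_zero_eq_eval_zero] at h
    simpa [hnorm_a] using h
  have hb_le : ‖b‖ ≤ ‖b‖ ^ (φ.natDegree - 1) := le_self_pow₀ hb.le (by omega)
  have heval : ‖φ.eval b‖ ≤ ‖b‖ ^ (φ.natDegree - 1) := by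
    have h := IsUltrametricDist.norm_add_le_max (φ.eval b - b) b
    rw [sub_add_cancel] at h
    exact h.trans (max_le (hconst.trans (hb.le.trans hb_le)) hb_le)
  have hlt : ‖b‖ ^ (φ.natDegree - 1) < ‖b‖ ^ φ.natDegree := pow_lt_pow_right₀ hb (by omega)
  have hle : ‖b‖ ^ φ.natDegree ≤ ‖b‖ ^ (φ.natDegree - 1) := by
    have h := IsUltrametricDist.norm_add_le_max (φ.eval b)
      (-(φ.eval b - φ.leadingCoeff * b ^ φ.natDegree))
    rw [norm_neg, ← sub_eq_add_neg, sub_sub_cancel, norm_mul, hlead, one_mul, norm_pow] at h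
    exact h.trans (max_le heval (norm_eval_sub_leadingTerm_le φ hcoeff b hb.le))
  exact hlt.not_ge hle
end

section
/- (Polynomial case of Lemma 3.1.) Let φ ∈ O_L[X] be a polynomial of degree d ≥ 2 with good reduction, and let c ∈ O_L be such that its residue c̄ ∈ k satisfies φ̃(c̄) = c̄ and φ̃'(c̄) = 0 (i.e. the direction c̄ at the Gauss point is fixed by the reduction and has directional multiplicity at least 2). Then there exists x ∈ A¹_an with x(X − c) < 1 such that φ_*x ≠ x and (φ_*x)(P) ≤ x(P) for every P ∈ L[X] (i.e. x lies on the arc from the Gauss point to φ_*x). -/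
open Polynomial

/-- A point of the Berkovich affine line `A¹_an` over `L`: a multiplicative ring seminorm
on `L[X]` whose restriction to the constant polynomials is the given absolute value of `L`. -/
structure BerkovichPoint (L : Type*) [NontriviallyNormedField L] where
  toFun : Polynomial L → ℝ
  nonneg' : ∀ P, 0 ≤ toFun P
  map_mul' : ∀ P Q, toFun (P * Q) = toFun P * toFun Q
  add_le' : ∀ P Q, toFun (P + Q) ≤ toFun P + toFun Q
  const' : ∀ a : L, toFun (C a) = ‖a‖

namespace BerkovichPoint

variable {L : Type*} [NontriviallyNormedField L]

/-- The topology of pointwise convergence on the Berkovich affine line. -/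
instance : TopologicalSpace (BerkovichPoint L) :=
  TopologicalSpace.induced (fun x => x.toFun) Pi.topologicalSpace

/-- The Gauss norm of a polynomial: the maximum of the absolute values of its coefficients.
The Gauss point `ζ_G` is the point of the Berkovich affine line given by this seminorm. -/
noncomputable def gaussNorm (P : Polynomial L) : ℝ := ⨆ i : ℕ, ‖P.coeff i‖

/-- The type 1 (evaluation) point of the Berkovich affine line attached to `a ∈ L`:
`ev_a(P) = ‖P(a)‖`. -/
noncomputable def evPoint (a : L) : BerkovichPoint L where
  toFun P := ‖P.eval a‖
  nonneg' P := norm_nonneg _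
  map_mul' P Q := by simp
  add_le' P Q := by simp only [eval_add]; exact norm_add_le _ _
  const' b := by simp

/-- The action of a polynomial `φ` on the Berkovich affine line by pushforward:
`(φ_* x)(P) = x(P ∘ φ)`.  The fixed point locus of `φ` is `{x | pushforward φ x = x}`. -/
noncomputable def pushforward (φ : Polynomial L) (x : BerkovichPoint L) : BerkovichPoint L where
  toFun P := x.toFun (P.comp φ)
  nonneg' P := x.nonneg' _
  map_mul' P Q := by simp only [mul_comp]; exact x.map_mul' _ _
  add_le' P Q := by simp only [add_comp]; exact x.add_le' _ _
  const' a := by simp only [C_comp]; exact x.const' a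

end BerkovichPoint

open BerkovichPoint

namespace Polynomial

/-- Composition with a polynomial of Gauss norm at most `r` does not increase the Gauss norm
at radius `r`. -/
theorem gaussNorm_comp_le_of_gaussNorm_le {R : Type*} [CommRing R] {v : AbsoluteValue R ℝ}
    (hna : IsNonarchimedean v) {r : ℝ} (hr : 0 < r) (P : R[X]) {f : R[X]}
    (hf : f.gaussNorm v r ≤ r) : (P.comp f).gaussNorm v r ≤ P.gaussNorm v r := by
  have := gaussNorm_isAbsoluteValue hna hr
  rw [comp_eq_sum_left, Polynomial.sum]
  obtain ⟨i, -, hi⟩ := (isNonarchimedean_gaussNorm v hna hr.le).finset_image_add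
    (gaussNorm_zero v r) (fun p => gaussNorm_nonneg v p hr.le)
    (fun e => C (P.coeff e) * f ^ e) P.support
  refine hi.trans (le_trans ?_ (P.le_gaussNorm v hr.le i))
  rcases subsingleton_or_nontrivial R with h | h
  · simp [Subsingleton.elim f 0, Subsingleton.elim (P.coeff i) 0]
  · rw [gaussNorm_mul hna hr, gaussNorm_C, IsAbsoluteValue.abv_pow (Polynomial.gaussNorm v r)]
    gcongr
    exact gaussNorm_nonneg v f hr.le

/-- The coefficients of a Taylor expansion at an integral point of a polynomial with integral
coefficients are integral. -/
theorem apply_coeff_taylor_le_one {R : Type*} [CommRing R] [Nontrivial R] {v : AbsoluteValue R ℝ}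
    (hna : IsNonarchimedean v) {P : R[X]} (hP : ∀ i, v (P.coeff i) ≤ 1) {c : R} (hc : v c ≤ 1)
    (n : ℕ) : v ((taylor c P).coeff n) ≤ 1 := by
  have hX : (X + C c).gaussNorm v 1 ≤ 1 := by
    refine (isNonarchimedean_gaussNorm v hna zero_le_one _ _).trans (max_le ?_ ?_)
    · simp [← monomial_one_one_eq_X]
    · simpa using hc
  have hle := gaussNorm_comp_le_of_gaussNorm_le hna one_pos P hX
  obtain ⟨i, hi⟩ := exists_eq_gaussNorm v 1 P
  have hn := (taylor c P).le_gaussNorm v zero_le_one n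
  rw [taylor_apply] at hn ⊢
  rw [one_pow, mul_one] at hi hn
  exact hn.trans (hle.trans (hi.trans_le (hP i)))

end Polynomial

namespace BerkovichPoint

/-- The point of the Berkovich affine line attached to the disc of centre `c` and radius `r`. -/
noncomputable def discPoint {L : Type*} [NontriviallyNormedField L]
    (hna : IsNonarchimedean (fun x : L => ‖x‖)) (c : L) {r : ℝ} (hr : 0 < r) :
    BerkovichPoint L where
  toFun P := (taylor c P).gaussNorm (NormedField.toAbsoluteValue L) r
  nonneg' P := gaussNorm_nonneg _ _ hr.le
  map_mul' P Q := by
    rw [taylor_mul]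
    exact gaussNorm_mul (v := NormedField.toAbsoluteValue L) hna hr _ _
  add_le' P Q := by
    rw [map_add]
    exact (isNonarchimedean_gaussNorm (NormedField.toAbsoluteValue L) hna hr.le).add_le
      (fun p => gaussNorm_nonneg _ p hr.le)
  const' a := by
    rw [taylor_C, Polynomial.gaussNorm_C]
    rfl

end BerkovichPoint

/-- Polynomial case of Lemma 3.1: if `φ` has good reduction and `c ∈ O_L` reduces to a fixed
critical point of the reduction `φ̃` (i.e. `‖φ(c) − c‖ < 1` and `‖φ'(c)‖ < 1`), then there
is a point `x` in the direction of `c` at the Gauss point (`x(X − c) < 1`) which is not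
fixed by `φ` and which lies on the arc from the Gauss point to `φ_* x`
(i.e. `(φ_* x)(P) ≤ x(P)` for all `P`). -/
theorem exists_point_moved_outward_in_fixed_critical_direction
    (L : Type*) [NontriviallyNormedField L] [CompleteSpace L] [IsAlgClosed L] [CharZero L]
    (hna : IsNonarchimedean (fun x : L => ‖x‖))
    (φ : L[X]) (d : ℕ) (hd : 2 ≤ d) (hdeg : φ.natDegree = d)
    (hcoeff : ∀ i, ‖φ.coeff i‖ ≤ 1) (hlead : ‖φ.leadingCoeff‖ = 1)
    (c : L) (hc : ‖c‖ ≤ 1)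
    (hfix : ‖φ.eval c - c‖ < 1) (hcrit : ‖(derivative φ).eval c‖ < 1) :
    ∃ x : BerkovichPoint L, x.toFun (X - C c) < 1 ∧
      pushforward φ x ≠ x ∧
      ∀ P : L[X], (pushforward φ x).toFun P ≤ x.toFun P := by
  set v := NormedField.toAbsoluteValue L
  have hv : IsNonarchimedean v := hna
  obtain ⟨r, hr_fix, hr_one⟩ := exists_between hfix
  have hr : 0 < r := (norm_nonneg _).trans_lt hr_fix
  have hf : (taylor c φ - C c).gaussNorm v r < r := by
    obtain ⟨i, hi⟩ := exists_eq_gaussNorm v r (taylor c φ - C c)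
    rw [hi, coeff_sub]
    match i with
    | 0 =>
      rw [taylor_coeff_zero, coeff_C_zero, pow_zero, mul_one]
      exact hr_fix
    | 1 =>
      rw [taylor_coeff_one, coeff_C_succ, sub_zero, pow_one]
      exact mul_lt_of_lt_one_left hr hcrit
    | n + 2 =>
      rw [coeff_C_succ, sub_zero]
      calc v ((taylor c φ).coeff (n + 2)) * r ^ (n + 2) ≤ 1 * r ^ (n + 2) := by
            gcongr
            exact apply_coeff_taylor_le_one hv hcoeff hc _
        _ < r := by
            rw [one_mul]
            exact pow_lt_self_of_lt_one₀ hr hr_one (by omega)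
  have hx : (discPoint hna c hr).toFun (X - C c) = r := by
    have h : taylor c (X - C c) = monomial 1 1 := by simp [monomial_one_one_eq_X]
    change (taylor c (X - C c)).gaussNorm v r = r
    rw [h, gaussNorm_monomial, map_one, one_mul, pow_one]
  refine ⟨discPoint hna c hr, hx.trans_lt hr_one, fun h => ?_, fun P => ?_⟩
  · refine hf.ne ?_
    have h' := congrArg (fun x => x.toFun (X - C c)) h
    rw [hx] at h'
    simpa [pushforward, discPoint, v] using h'
  · have h : taylor c (P.comp φ) = (taylor c P).comp (taylor c φ - C c) := by
      simp [taylor_apply, comp_assoc]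
    change (taylor c (P.comp φ)).gaussNorm v r ≤ (taylor c P).gaussNorm v r
    rw [h]
    exact gaussNorm_comp_le_of_gaussNorm_le hv hr _ hf.le
end

section
/- (Polynomial case of Lemma 3.8.) Let φ ∈ O_L[X] be a polynomial of degree d ≥ 2 with good reduction, and let c ∈ O_L be such that its residue c̄ ∈ k satisfies φ̃(c̄) = c̄ and φ̃'(c̄) = 0 (a residually fixed critical direction at the Gauss point). Then every fixed point of φ in that direction is of type 1: if x ∈ Fix(φ) satisfies x(X − c) < 1, then there exists a ∈ L with ‖a − c‖ < 1 and φ(a) = a such that x = ev_a, i.e. x(P) = ‖P(a)‖ for all P ∈ L[X]. -/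
open Polynomial

open BerkovichPoint

namespace BerkovichPoint

variable {L : Type*} [NontriviallyNormedField L]

lemma toFun_pow (x : BerkovichPoint L) (P : L[X]) (n : ℕ) :
    x.toFun (P ^ n) = x.toFun P ^ n := by
  induction n with
  | zero => simpa using x.const' 1
  | succ n ih => rw [pow_succ, x.map_mul', ih, pow_succ]

lemma toFun_zero (x : BerkovichPoint L) : x.toFun 0 = 0 := by
  simpa using x.const' 0

lemma toFun_sum_le (x : BerkovichPoint L) {ι : Type*} (s : Finset ι) (f : ι → L[X]) :
    x.toFun (∑ i ∈ s, f i) ≤ ∑ i ∈ s, x.toFun (f i) := by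
  classical
  induction s using Finset.induction_on with
  | empty => simp [x.toFun_zero]
  | insert a s ha ih =>
    rw [Finset.sum_insert ha, Finset.sum_insert ha]
    exact (x.add_le' _ _).trans (by gcongr)

/-- Over a nonarchimedean field, every multiplicative seminorm on `L[X]` extending the absolute
value is nonarchimedean. -/
lemma toFun_add_le_max [IsUltrametricDist L] (x : BerkovichPoint L) (P Q : L[X]) :
    x.toFun (P + Q) ≤ max (x.toFun P) (x.toFun Q) := by
  set M := max (x.toFun P) (x.toFun Q) with hM
  have hP : x.toFun P ≤ M := le_max_left _ _
  have hQ : x.toFun Q ≤ M := le_max_right _ _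
  have hP0 := x.nonneg' P
  have hQ0 := x.nonneg' Q
  have hM0 : 0 ≤ M := hP0.trans hP
  have hpow (m : ℕ) : x.toFun (P + Q) ^ m ≤ (m + 1) * M ^ m := by
    rw [← x.toFun_pow, add_pow]
    refine (x.toFun_sum_le _ _).trans ?_
    have hterm : ∀ k ∈ Finset.range (m + 1),
        x.toFun (P ^ k * Q ^ (m - k) * (m.choose k : L[X])) ≤ M ^ m := by
      intro k hk
      have hkm : k + (m - k) = m := by
        have := Finset.mem_range.1 hk
        omega
      have hchoose : x.toFun (m.choose k : L[X]) ≤ 1 := by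
        rw [← Polynomial.C_eq_natCast, x.const']
        exact IsUltrametricDist.norm_natCast_le_one L _
      calc x.toFun (P ^ k * Q ^ (m - k) * (m.choose k : L[X]))
          = x.toFun P ^ k * x.toFun Q ^ (m - k) * x.toFun (m.choose k : L[X]) := by
            rw [x.map_mul', x.map_mul', x.toFun_pow, x.toFun_pow]
        _ ≤ M ^ k * M ^ (m - k) * 1 := by
            have := x.nonneg' (m.choose k : L[X])
            gcongr
        _ = M ^ m := by rw [mul_one, ← pow_add, hkm]
    simpa using Finset.sum_le_sum hterm
  by_contra! hlt
  rcases hM0.eq_or_lt with h0 | h0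
  · have := x.add_le' P Q
    linarith
  · obtain ⟨m, hm⟩ := Real.exists_natCast_add_one_lt_pow_of_one_lt ((one_lt_div h0).2 hlt)
    rw [div_pow, lt_div_iff₀ (by positivity)] at hm
    exact absurd (hpow m) (not_le.2 hm)

lemma toFun_neg (x : BerkovichPoint L) (P : L[X]) : x.toFun (-P) = x.toFun P := by
  have h : -P = C (-1) * P := by simp
  rw [h, x.map_mul', x.const']
  simp

/-- A point annihilating `X - a` is the evaluation point at `a`. -/
lemma toFun_eq_norm_eval_of_toFun_X_sub_C_eq_zero (x : BerkovichPoint L) {a : L}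
    (ha : x.toFun (X - C a) = 0) (P : L[X]) : x.toFun P = ‖P.eval a‖ := by
  obtain ⟨S, hS⟩ := X_sub_C_dvd_sub_C_eval (a := a) (p := P)
  have h0 : x.toFun (P - C (P.eval a)) = 0 := by rw [hS, x.map_mul', ha, zero_mul]
  rw [← x.const']
  apply le_antisymm
  · have := x.add_le' (P - C (P.eval a)) (C (P.eval a))
    rwa [sub_add_cancel, h0, zero_add] at this
  · have := x.add_le' (-(P - C (P.eval a))) P
    rwa [toFun_neg, h0, zero_add, neg_sub, sub_add_cancel] at this

/-- A point of the closed unit disk is bounded by `1` on polynomials with integral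
coefficients. -/
lemma toFun_map_le_one [IsUltrametricDist L] (x : BerkovichPoint L) (hX : x.toFun X ≤ 1)
    (P : (NormedField.valuation (K := L)).integer[X]) :
    x.toFun (P.map (Subring.subtype _)) ≤ 1 := by
  induction P using Polynomial.induction_on' with
  | add P Q hP hQ =>
    rw [Polynomial.map_add]
    exact (x.toFun_add_le_max _ _).trans (max_le hP hQ)
  | monomial n r =>
    rw [map_monomial, ← C_mul_X_pow_eq_monomial, x.map_mul', x.const', x.toFun_pow]
    exact mul_le_one₀ r.2 (pow_nonneg (x.nonneg' _) _) (pow_le_one₀ (x.nonneg' _) hX)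

end BerkovichPoint

/-- If a polynomial with unit leading coefficient takes a small value at `c`, then it has a root
in the open unit disk around `c`. -/
lemma exists_isRoot_norm_sub_lt_one {L : Type*} [NontriviallyNormedField L] [IsAlgClosed L]
    {ψ : L[X]} (hlead : ‖ψ.leadingCoeff‖ = 1) {c : L} (hc : ‖ψ.eval c‖ < 1) :
    ∃ a, ψ.eval a = 0 ∧ ‖a - c‖ < 1 := by
  by_contra! h
  rw [(IsAlgClosed.splits ψ).eval_eq_prod_roots, norm_mul, hlead, one_mul] at hc
  refine absurd hc (not_lt.2 ?_)
  have hroot : ∀ a ∈ ψ.roots, 1 ≤ ‖c - a‖ := fun a ha => by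
    rw [norm_sub_rev]
    exact h a (isRoot_of_mem_roots ha)
  generalize ψ.roots = s at hroot
  induction s using Multiset.induction_on with
  | empty => simp
  | cons a s ih =>
    rw [Multiset.map_cons, Multiset.prod_cons, norm_mul]
    exact one_le_mul_of_one_le_of_one_le (hroot a (Multiset.mem_cons_self a s))
      (ih fun b hb => hroot b (Multiset.mem_cons_of_mem hb))

/-- Polynomial case of Lemma 3.8: if `φ` has good reduction and `c ∈ O_L` reduces to a fixed
critical point of the reduction `φ̃` (a residually fixed critical direction at the Gauss
point), then every Berkovich fixed point of `φ` in that direction is of type 1: it is the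
evaluation point at some classical fixed point `a` with `‖a − c‖ < 1`. -/
theorem fixed_point_in_fixed_critical_direction_is_type_one
    (L : Type*) [NontriviallyNormedField L] [CompleteSpace L] [IsAlgClosed L] [CharZero L]
    (hna : IsNonarchimedean (fun x : L => ‖x‖))
    (φ : L[X]) (d : ℕ) (hd : 2 ≤ d) (hdeg : φ.natDegree = d)
    (hcoeff : ∀ i, ‖φ.coeff i‖ ≤ 1) (hlead : ‖φ.leadingCoeff‖ = 1)
    (c : L) (hc : ‖c‖ ≤ 1)
    (hfix : ‖φ.eval c - c‖ < 1) (hcrit : ‖(derivative φ).eval c‖ < 1)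
    (x : BerkovichPoint L) (hx : pushforward φ x = x) (hxc : x.toFun (X - C c) < 1) :
    ∃ a : L, ‖a - c‖ < 1 ∧ φ.eval a = a ∧ ∀ P : L[X], x.toFun P = ‖P.eval a‖ := by
  have : IsUltrametricDist L := IsUltrametricDist.isUltrametricDist_of_isNonarchimedean_norm hna
  have hX : φ.natDegree > (X : L[X]).natDegree := by
    rw [natDegree_X]
    omega
  obtain ⟨a, ha, hac⟩ := exists_isRoot_norm_sub_lt_one (ψ := φ - X) (c := c)
    (by rwa [leadingCoeff_sub_of_degree_lt (degree_lt_degree hX)]) (by simpa using hfix)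
  have hφa : φ.eval a = a := by simpa [sub_eq_zero] using ha
  refine ⟨a, hac, hφa, x.toFun_eq_norm_eval_of_toFun_X_sub_C_eq_zero ?_⟩
  have ha1 : ‖a‖ ≤ 1 := by
    have := IsUltrametricDist.norm_add_le_max (a - c) c
    rw [sub_add_cancel] at this
    exact this.trans (max_le hac.le hc)
  have hxa : x.toFun (X - C a) < 1 := by
    have := x.toFun_add_le_max (X - C c) (C (-(a - c)))
    rw [x.const', norm_neg] at this
    refine lt_of_eq_of_lt (congrArg _ ?_) (this.trans_lt (max_lt hxc hac))
    simp
  have hxX : x.toFun X ≤ 1 := by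
    have := x.toFun_add_le_max (X - C a) (C a)
    rw [sub_add_cancel, x.const'] at this
    exact this.trans (max_le hxa.le ha1)
  let O := (NormedField.valuation (K := L)).integer
  obtain ⟨ψ, hψ⟩ : ∃ ψ : O[X], ψ.map O.subtype = φ := by
    rw [← Set.mem_range, ← lifts_iff_set_range, lifts_iff_coeff_lifts]
    exact fun n => ⟨⟨φ.coeff n, hcoeff n⟩, rfl⟩
  obtain ⟨α, rfl⟩ : ∃ α : O, O.subtype α = a := ⟨⟨a, ha1⟩, rfl⟩
  obtain ⟨γ, rfl⟩ : ∃ γ : O, O.subtype γ = c := ⟨⟨c, hc⟩, rfl⟩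
  have hder : ‖(derivative φ).eval (O.subtype α)‖ < 1 := by
    obtain ⟨z, hz⟩ := evalSubFactor (derivative ψ) α γ
    have hz' := congrArg O.subtype hz
    rw [map_sub, map_mul, map_sub, ← eval_map_apply, ← eval_map_apply, ← derivative_map, hψ,
      sub_eq_iff_eq_add] at hz'
    rw [hz']
    refine (IsUltrametricDist.norm_add_le_max _ _).trans_lt (max_lt ?_ hcrit)
    rw [norm_mul]
    exact mul_lt_one_of_nonneg_of_lt_one_right z.2 (norm_nonneg _) hac
  obtain ⟨k, hk⟩ := binomExpansion (ψ.map C) (C α) (X - C α)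
  have hexp : φ - C (O.subtype α) = (X - C (O.subtype α)) *
      (C ((derivative φ).eval (O.subtype α)) + (X - C (O.subtype α)) * k.map O.subtype) := by
    rw [add_sub_cancel, eval_map, eval₂_C_X, derivative_map, eval_map_apply, eval_map_apply] at hk
    have hk' := congrArg (Polynomial.map O.subtype) hk
    simp only [Polynomial.map_add, Polynomial.map_mul, Polynomial.map_pow, Polynomial.map_sub,
      map_X, map_C] at hk'
    rw [← eval_map_apply O.subtype (p := ψ), ← eval_map_apply O.subtype (p := derivative ψ),
      ← derivative_map, hψ, hφa] at hk'
    linear_combination hk'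
  have hfixed : x.toFun (φ - C (O.subtype α)) = x.toFun (X - C (O.subtype α)) := by
    have := congrArg (fun y => y.toFun (X - C (O.subtype α))) hx
    simpa [pushforward] using this
  have hQ : x.toFun (C ((derivative φ).eval (O.subtype α)) +
      (X - C (O.subtype α)) * k.map O.subtype) < 1 := by
    refine (x.toFun_add_le_max _ _).trans_lt (max_lt (by rwa [x.const']) ?_)
    rw [x.map_mul']
    exact mul_lt_one_of_nonneg_of_lt_one_left (x.nonneg' _) hxa (x.toFun_map_le_one hxX k)
  rw [hexp, x.map_mul'] at hfixed
  by_contra h0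
  exact hQ.ne (mul_left_cancel₀ h0 (hfixed.trans (mul_one _).symm))
end

section
/- (Polynomial case of Theorem 1.1 / Theorem 3.2.) Let φ ∈ O_L[X] be a polynomial of degree d ≥ 2 with good reduction. Then the fixed point locus Fix(φ) ⊆ A¹_an (with the topology of pointwise convergence) is connected if and only if the reduction φ̃ ∈ k[X] has no affine fixed critical point, i.e. there is no c ∈ k with φ̃(c) = c and φ̃'(c) = 0. -/
open Polynomial

open BerkovichPoint

namespace BerkovichPoint

variable {L : Type*} [NontriviallyNormedField L]

instance : FunLike (BerkovichPoint L) L[X] ℝ where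
  coe := toFun
  coe_injective x y h := by cases x; cases y; congr

@[simp]
theorem apply_C (x : BerkovichPoint L) (a : L) : x (C a) = ‖a‖ := x.const' a

instance : MulRingSeminormClass (BerkovichPoint L) L[X] ℝ where
  map_mul x := x.map_mul'
  map_add_le_add x := x.add_le'
  map_one x := by simpa using x.apply_C 1
  map_zero x := by simpa using x.apply_C 0
  map_neg_eq_map x P := by
    have h := x.map_mul' (C (-1)) P
    rwa [x.const', norm_neg, norm_one, one_mul, C_neg, C_1, neg_one_mul] at h

@[simp]
theorem evPoint_apply (a : L) (P : L[X]) : evPoint a P = ‖P.eval a‖ := rfl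

theorem pushforward_apply (φ : L[X]) (x : BerkovichPoint L) (P : L[X]) :
    pushforward φ x P = x (P.comp φ) := rfl

theorem continuous_apply_const (P : L[X]) : Continuous fun x : BerkovichPoint L => x P :=
  (continuous_apply P).comp continuous_induced_dom

theorem continuous_of_apply {T : Type*} [TopologicalSpace T] {f : T → BerkovichPoint L}
    (hf : ∀ P : L[X], Continuous fun t => f t P) : Continuous f :=
  continuous_induced_rng.2 (continuous_pi hf)

/-- Over an algebraically closed field, a point is determined by its values on the monic
linear polynomials. -/
theorem ext_of_X_sub_C [IsAlgClosed L] {x y : BerkovichPoint L}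
    (h : ∀ b : L, x (X - C b) = y (X - C b)) : x = y := by
  refine DFunLike.ext x y fun P => ?_
  rw [(IsAlgClosed.splits P).eq_prod_roots, map_mul, map_mul, apply_C, apply_C,
    map_multiset_prod, map_multiset_prod, Multiset.map_map, Multiset.map_map]
  congr 2
  exact Multiset.map_congr rfl fun b _ => h b

theorem pushforward_eq_self_iff [IsAlgClosed L] {φ : L[X]} {x : BerkovichPoint L} :
    pushforward φ x = x ↔ ∀ b : L, x (φ - C b) = x (X - C b) := by
  refine ⟨fun h b => ?_, fun h => ext_of_X_sub_C fun b => ?_⟩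
  · conv_rhs => rw [← h]
    simp [pushforward_apply]
  · simpa [pushforward_apply] using h b

theorem isNonarchimedean (hna : IsNonarchimedean (fun x : L => ‖x‖)) (x : BerkovichPoint L) :
    IsNonarchimedean x := by
  have hnat (n : ℕ) : ‖(n : L)‖ ≤ 1 :=
    hna.apply_natCast_le_one (f := NormedField.toMulRingNorm L)
  intro P Q
  set M := max (x P) (x Q) with hM
  have hM0 : 0 ≤ M := (apply_nonneg x P).trans (le_max_left _ _)
  have hpow (m : ℕ) : x (P + Q) ^ m ≤ (m + 1) * M ^ m := by
    rw [← map_pow, add_pow]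
    calc
      _ ≤ ∑ k ∈ Finset.range (m + 1), x (P ^ k * Q ^ (m - k) * (m.choose k : L[X])) :=
        Finset.le_sum_of_subadditive x (map_zero x).le (map_add_le_add x) _ _
      _ ≤ ∑ k ∈ Finset.range (m + 1), M ^ m := by
        refine Finset.sum_le_sum fun k hk => ?_
        have hk' : k + (m - k) = m := by have := Finset.mem_range.1 hk; omega
        rw [map_mul, map_mul, map_pow, map_pow, ← C_eq_natCast, apply_C]
        calc
          _ ≤ M ^ k * M ^ (m - k) * 1 := by
            gcongr
            · exact le_max_left _ _
            · exact le_max_right _ _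
            · exact hnat _
          _ = M ^ m := by rw [mul_one, ← pow_add, hk']
      _ = _ := by simp
  refine le_of_forall_gt_imp_ge_of_dense fun a ha => ?_
  rcases hM0.eq_or_lt with h0 | h0
  · have := hpow 1
    rw [← h0] at this ha
    simp only [pow_one, mul_zero] at this
    exact this.trans ha.le
  · obtain ⟨m, hm⟩ := Real.exists_natCast_add_one_lt_pow_of_one_lt ((one_lt_div h0).2 ha)
    rw [div_pow, lt_div_iff₀ (by positivity)] at hm
    refine le_of_pow_le_pow_left₀ (fun h => ?_) (h0.trans ha).le ((hpow m).trans hm.le)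
    simp [h] at hm

theorem max_apply_sub_C_one (hna : IsNonarchimedean (fun x : L => ‖x‖)) {x : BerkovichPoint L}
    {P : L[X]} (hP : x P ≤ 1) (b : L) : max (x (P - C b)) 1 = max ‖b‖ 1 := by
  have h := x.isNonarchimedean hna
  refine le_antisymm (max_le ?_ (le_max_right _ _)) (max_le ?_ (le_max_right _ _))
  · have := h P (-C b)
    rw [map_neg_eq_map, apply_C, ← sub_eq_add_neg] at this
    exact this.trans (max_le (hP.trans (le_max_right _ _)) (le_max_left _ _))
  · have := h P (-(P - C b))
    rw [map_neg_eq_map, ← sub_eq_add_neg, sub_sub_cancel, apply_C] at this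
    exact this.trans (max_le (hP.trans (le_max_right _ _)) (le_max_left _ _))

theorem gaussNorm_mul (hna : IsNonarchimedean (fun x : L => ‖x‖)) (x : BerkovichPoint L)
    {t : ℝ} (ht : 0 ≤ t) (p q : L[X][X]) :
    (p * q).gaussNorm x t = p.gaussNorm x t * q.gaussNorm x t := by
  have hx := x.isNonarchimedean hna
  refine le_antisymm (Polynomial.gaussNorm_mul_le x hx p q ht) ?_
  obtain ⟨i, hi, hlti⟩ := p.exists_min_eq_gaussNorm x ht
  obtain ⟨j, hj, hltj⟩ := q.exists_min_eq_gaussNorm x ht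
  rcases (p.gaussNorm_nonneg x ht).eq_or_lt with hp | hp
  · rw [← hp, zero_mul]
    exact (p * q).gaussNorm_nonneg x ht
  rcases (q.gaussNorm_nonneg x ht).eq_or_lt with hq | hq
  · rw [← hq, mul_zero]
    exact (p * q).gaussNorm_nonneg x ht
  have hsum : x ((p * q).coeff (i + j)) = x (p.coeff i * q.coeff j) := by
    rw [coeff_mul]
    refine hx.apply_sum_eq_of_lt (f := x) (k := (i, j)) (fun _ => (map_neg_eq_map x _).symm)
      (by simp) ?_
    rintro ⟨a, b⟩ hab hne
    have hab : a + b = i + j := Finset.HasAntidiagonal.mem_antidiagonal.1 hab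
    dsimp only
    refine lt_of_mul_lt_mul_right ?_ (pow_nonneg ht (i + j))
    have key : x (p.coeff a) * t ^ a * (x (q.coeff b) * t ^ b) <
        x (p.coeff i) * t ^ i * (x (q.coeff j) * t ^ j) := by
      rw [← hi, ← hj]
      rcases lt_trichotomy a i with h | h | h
      · exact (mul_le_mul_of_nonneg_left (q.le_gaussNorm x ht b)
          (mul_nonneg (apply_nonneg x _) (pow_nonneg ht a))).trans_lt
          (mul_lt_mul_of_pos_right (hlti a h) hq)
      · exact absurd (Prod.ext h (by dsimp only; omega)) hne
      · exact (mul_le_mul_of_nonneg_right (p.le_gaussNorm x ht a)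
          (mul_nonneg (apply_nonneg x _) (pow_nonneg ht b))).trans_lt
          (mul_lt_mul_of_pos_left (hltj b (by omega)) hp)
    rw [map_mul, map_mul]
    nth_rewrite 1 [← hab]
    rw [pow_add, pow_add]
    linarith
  calc
    _ = x ((p * q).coeff (i + j)) * t ^ (i + j) := by
      rw [hi, hj, hsum, map_mul, pow_add]; ring
    _ ≤ _ := (p * q).le_gaussNorm x ht _

/-- The polynomial `P(X + T)`, as a polynomial in `T` with coefficients in `L[X]`. -/
noncomputable def translate : L[X] →+* L[X][X] :=
  (taylorAlgHom (X : L[X])).toRingHom.comp (mapRingHom C)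

theorem coeff_translate (P : L[X]) (i : ℕ) : (translate P).coeff i = hasseDeriv i P := by
  have h : (translate P).coeff i = (taylor X (P.map C)).coeff i := rfl
  have hmap : hasseDeriv i (P.map C) = (hasseDeriv i P).map (C : L →+* L[X]) := by
    ext1 n
    simp [hasseDeriv_coeff]
  rw [h, taylor_coeff, hmap, eval_map, eval₂_C_X]

/-- The point `P ↦ maxᵢ x(∂ᵢP) tⁱ`, where `∂ᵢ` is the `i`-th Hasse derivative: the image of `x`
under the canonical retraction of the affine line at radius `t`. -/
noncomputable def thicken (hna : IsNonarchimedean (fun x : L => ‖x‖)) (x : BerkovichPoint L)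
    (t : NNReal) : BerkovichPoint L where
  toFun P := (translate P).gaussNorm x t
  nonneg' P := Polynomial.gaussNorm_nonneg x _ t.2
  map_mul' P Q := by rw [map_mul]; exact gaussNorm_mul hna x t.2 _ _
  add_le' P Q := by
    rw [map_add]
    exact (Polynomial.isNonarchimedean_gaussNorm x (x.isNonarchimedean hna) t.2).add_le
      (fun p => p.gaussNorm_nonneg x t.2)
  const' a := by
    have : translate (C a) = C (C a) := by simp [translate]
    rw [this, Polynomial.gaussNorm_C, apply_C]

section Thicken

variable (hna : IsNonarchimedean (fun x : L => ‖x‖))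

theorem thicken_apply (x : BerkovichPoint L) (t : NNReal) (P : L[X]) :
    thicken hna x t P = (translate P).gaussNorm x t := rfl

theorem le_thicken (x : BerkovichPoint L) (t : NNReal) (P : L[X]) (i : ℕ) :
    x (hasseDeriv i P) * t ^ i ≤ thicken hna x t P := by
  rw [thicken_apply, ← coeff_translate]
  exact Polynomial.le_gaussNorm x _ t.2 i

theorem exists_eq_thicken (x : BerkovichPoint L) (t : NNReal) (P : L[X]) :
    ∃ i, thicken hna x t P = x (hasseDeriv i P) * t ^ i := by
  simp_rw [thicken_apply, ← coeff_translate]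
  exact Polynomial.exists_eq_gaussNorm x _ _

theorem thicken_zero (x : BerkovichPoint L) : thicken hna x 0 = x := by
  refine DFunLike.ext _ _ fun P => ?_
  rw [thicken_apply, NNReal.coe_zero, Polynomial.gaussNorm_zero_right, coeff_translate,
    hasseDeriv_zero']

theorem continuous_thicken (x : BerkovichPoint L) : Continuous (thicken hna x) := by
  refine continuous_of_apply fun P => ?_
  simp only [thicken_apply, Polynomial.gaussNorm]
  split_ifs with h
  · exact Continuous.finset_sup'_apply h fun i _ => by fun_prop
  · exact continuous_const

/-- If the higher Hasse derivatives of `P` have size at most `1` at `x`, and the value `t` is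
attained by one of the corresponding terms, then thickening only adds `t` to the maximum. -/
theorem thicken_sub_C (x : BerkovichPoint L) {t : NNReal} (ht : t ≤ 1) {P : L[X]}
    (hP : ∀ i ≠ 0, x (hasseDeriv i P) ≤ 1)
    (hi : ∃ i ≠ 0, x (hasseDeriv i P) * (t : ℝ) ^ i = t) (b : L) :
    thicken hna x t (P - C b) = max (x (P - C b)) t := by
  have hd (i : ℕ) (hi : i ≠ 0) : hasseDeriv i (P - C b) = hasseDeriv i P := by
    rw [map_sub, hasseDeriv_C _ _ (Nat.pos_of_ne_zero hi), sub_zero]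
  refine le_antisymm ?_ (max_le ?_ ?_)
  · obtain ⟨i, h⟩ := exists_eq_thicken hna x t (P - C b)
    rw [h]
    rcases eq_or_ne i 0 with rfl | hi0
    · simp
    · rw [hd i hi0]
      refine le_max_of_le_right ?_
      calc
        _ ≤ 1 * (t : ℝ) ^ i := by gcongr; exact hP i hi0
        _ ≤ t := by rw [one_mul]; exact pow_le_of_le_one t.2 ht hi0
  · simpa using le_thicken hna x t (P - C b) 0
  · obtain ⟨i, hi0, h⟩ := hi
    rw [← hd i hi0] at h
    exact h.symm.le.trans (le_thicken hna x t (P - C b) i)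

theorem thicken_X_sub_C (x : BerkovichPoint L) {t : NNReal} (ht : t ≤ 1) (b : L) :
    thicken hna x t (X - C b) = max (x (X - C b)) t := by
  refine thicken_sub_C hna x ht (fun i hi => ?_) ⟨1, one_ne_zero, ?_⟩ b
  · obtain rfl | h : i = 1 ∨ 1 < i := by omega
    · simp
    · simp [hasseDeriv_X i h]
  · simp

theorem thicken_one_X_sub_C {x : BerkovichPoint L} (hx : x X ≤ 1) (b : L) :
    thicken hna x 1 (X - C b) = max ‖b‖ 1 := by
  rw [thicken_X_sub_C hna x le_rfl, NNReal.coe_one, max_apply_sub_C_one hna hx]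

theorem thicken_one_eq [IsAlgClosed L] {x y : BerkovichPoint L} (hx : x X ≤ 1) (hy : y X ≤ 1) :
    thicken hna x 1 = thicken hna y 1 :=
  ext_of_X_sub_C fun b => by rw [thicken_one_X_sub_C hna hx, thicken_one_X_sub_C hna hy]

end Thicken

theorem exists_root_of_norm_eval_lt_one [IsAlgClosed L] {P : L[X]}
    (hlead : ‖P.leadingCoeff‖ = 1) {c : L} (hc : ‖P.eval c‖ < 1) :
    ∃ a : L, P.eval a = 0 ∧ ‖c - a‖ < 1 := by
  by_contra! h
  have hP : P ≠ 0 := by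
    rintro rfl
    simp at hlead
  refine hc.not_ge ?_
  rw [(IsAlgClosed.splits P).eval_eq_prod_roots, norm_mul, hlead, one_mul]
  refine Multiset.prod_induction (fun y : L => 1 ≤ ‖y‖) _ (fun y z hy hz => ?_) (by simp)
    fun y hy => ?_
  · rw [norm_mul]
    exact one_le_mul_of_one_le_of_one_le hy hz
  · obtain ⟨a, ha, rfl⟩ := Multiset.mem_map.1 hy
    exact h a ((mem_roots hP).1 ha)

theorem apply_le_one (hna : IsNonarchimedean (fun x : L => ‖x‖))
    {x : BerkovichPoint L} (hx : x X ≤ 1) {P : L[X]}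
    (hP : ∀ i, ‖P.coeff i‖ ≤ 1) : x P ≤ 1 := by
  rw [P.as_sum_range_C_mul_X_pow]
  obtain ⟨j, -, hj⟩ := (x.isNonarchimedean hna).finset_image_add_of_nonempty
    (fun i => C (P.coeff i) * X ^ i) (Finset.nonempty_range_add_one (n := P.natDegree))
  refine hj.trans ?_
  rw [map_mul, map_pow, apply_C]
  exact mul_le_one₀ (hP j) (by positivity) (pow_le_one₀ (apply_nonneg x _) hx)

theorem norm_coeff_hasseDeriv_le_one (hna : IsNonarchimedean (fun x : L => ‖x‖))
    {P : L[X]} (hP : ∀ i, ‖P.coeff i‖ ≤ 1) (n i : ℕ) :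
    ‖(hasseDeriv n P).coeff i‖ ≤ 1 := by
  rw [hasseDeriv_coeff, norm_mul]
  exact mul_le_one₀ (hna.apply_natCast_le_one (f := NormedField.toMulRingNorm L))
    (norm_nonneg _) (hP _)

/-- Dividing `P - P(c)` by `X - c` preserves integrality of the coefficients. -/
theorem exists_sub_C_eval_eq_mul (hna : IsNonarchimedean (fun x : L => ‖x‖))
    {P : L[X]} (hP : ∀ i, ‖P.coeff i‖ ≤ 1) {c : L}
    (hc : ‖c‖ ≤ 1) :
    ∃ Q : L[X], (∀ i, ‖Q.coeff i‖ ≤ 1) ∧ P - C (P.eval c) = (X - C c) * Q := by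
  let O : Subring L :=
    { carrier := {a | ‖a‖ ≤ 1}
      mul_mem' := fun {a b} ha hb => by
        simpa using mul_le_one₀ ha (norm_nonneg _) hb
      one_mem' := by simp
      add_mem' := fun {a b} ha hb => (hna a b).trans (max_le ha hb)
      zero_mem' := by simp
      neg_mem' := fun {a} ha => by simpa using ha }
  obtain ⟨p, rfl⟩ : ∃ p : O[X], p.map O.subtype = P := by
    rw [← mem_lifts, lifts_iff_coeff_lifts]
    exact fun i => ⟨⟨_, hP i⟩, rfl⟩
  obtain ⟨q, hq⟩ := X_sub_C_dvd_sub_C_eval (a := (⟨c, hc⟩ : O)) (p := p)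
  refine ⟨q.map O.subtype, fun i => ?_, ?_⟩
  · rw [coeff_map]
    exact (q.coeff i).2
  · have h := congrArg (map O.subtype) hq
    have he : (p.map O.subtype).eval c = O.subtype (p.eval ⟨c, hc⟩) :=
      eval_map_apply (f := O.subtype) (⟨c, hc⟩ : O)
    simpa [he] using h

theorem apply_sub_C_eval_le (hna : IsNonarchimedean (fun x : L => ‖x‖))
    {x : BerkovichPoint L} (hx : x X ≤ 1) {P : L[X]}
    (hP : ∀ i, ‖P.coeff i‖ ≤ 1) {c : L} (hc : ‖c‖ ≤ 1) :
    x (P - C (P.eval c)) ≤ x (X - C c) := by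
  obtain ⟨Q, hQ, h⟩ := exists_sub_C_eval_eq_mul hna hP hc
  rw [h, map_mul]
  exact mul_le_of_le_one_right (apply_nonneg x _) (apply_le_one hna hx hQ)

theorem le_one_of_pushforward_eq_self [IsAlgClosed L] (hna : IsNonarchimedean (fun x : L => ‖x‖))
    {φ : L[X]} (hd : 2 ≤ φ.natDegree)
    (hφ : ∀ i, ‖φ.coeff i‖ ≤ 1) (hlead : ‖φ.leadingCoeff‖ = 1) {x : BerkovichPoint L}
    (hx : pushforward φ x = x) : x X ≤ 1 := by
  by_contra! h1
  have hfix : x φ = x X := by simpa using pushforward_eq_self_iff.1 hx 0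
  have hsum : x φ = x (C (φ.coeff φ.natDegree) * X ^ φ.natDegree) := by
    conv_lhs => rw [φ.as_sum_range_C_mul_X_pow]
    refine (x.isNonarchimedean hna).apply_sum_eq_of_lt (k := φ.natDegree)
      (f := x) (l := fun i => C (φ.coeff i) * X ^ i)
      (fun _ => (map_neg_eq_map x _).symm) (by simp) fun i hi hne => ?_
    have hi' : i < φ.natDegree := by
      have := Finset.mem_range.1 hi
      omega
    rw [map_mul, map_mul, map_pow, map_pow, apply_C, apply_C, coeff_natDegree, hlead, one_mul]
    exact (mul_le_of_le_one_left (by positivity) (hφ i)).trans_lt (pow_lt_pow_right₀ h1 hi')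
  rw [hfix, map_mul, map_pow, apply_C, coeff_natDegree, hlead, one_mul] at hsum
  have := pow_lt_pow_right₀ h1 (show 1 < φ.natDegree by omega)
  rw [pow_one] at this
  exact this.ne hsum

/-- The canonical retraction at radius `t ≤ 1` preserves fixed points, as soon as one of the
higher Taylor coefficients of `φ` contributes the value `t`. -/
theorem pushforward_thicken_eq_self [IsAlgClosed L] (hna : IsNonarchimedean (fun x : L => ‖x‖))
    {φ : L[X]}
    (hφ : ∀ i, ‖φ.coeff i‖ ≤ 1) {x : BerkovichPoint L} (hx1 : x X ≤ 1)
    (hx : pushforward φ x = x) {t : NNReal} (ht : t ≤ 1)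
    (hi : ∃ i ≠ 0, x (hasseDeriv i φ) * (t : ℝ) ^ i = t) :
    pushforward φ (thicken hna x t) = thicken hna x t := by
  rw [pushforward_eq_self_iff] at hx ⊢
  intro b
  rw [thicken_X_sub_C hna x ht, ← hx b]
  exact thicken_sub_C hna x ht
    (fun i _ => apply_le_one hna hx1 (norm_coeff_hasseDeriv_le_one hna hφ i)) hi b

end BerkovichPoint

/-- Polynomial case of Theorem 1.1 / Theorem 3.2: for a polynomial `φ ∈ O_L[X]` of degree
`d ≥ 2` with good reduction, the fixed point locus `Fix(φ) ⊆ A¹_an` is connected if and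
only if the reduction `φ̃` has no affine fixed critical point, i.e. there is no `c ∈ k`
with `φ̃(c) = c` and `φ̃'(c) = 0` (equivalently, no `c ∈ O_L` with `‖φ(c) − c‖ < 1` and
`‖φ'(c)‖ < 1`). -/
theorem fixed_locus_connected_iff_no_fixed_critical_point
    (L : Type*) [NontriviallyNormedField L] [CompleteSpace L] [IsAlgClosed L] [CharZero L]
    (hna : IsNonarchimedean (fun x : L => ‖x‖))
    (φ : L[X]) (d : ℕ) (hd : 2 ≤ d) (hdeg : φ.natDegree = d)
    (hcoeff : ∀ i, ‖φ.coeff i‖ ≤ 1) (hlead : ‖φ.leadingCoeff‖ = 1) :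
    IsConnected {x : BerkovichPoint L | pushforward φ x = x} ↔
      ¬ ∃ c : L, ‖c‖ ≤ 1 ∧ ‖φ.eval c - c‖ < 1 ∧ ‖(derivative φ).eval c‖ < 1 := by
  have hd' : 2 ≤ φ.natDegree := hdeg ▸ hd
  have hle {x : BerkovichPoint L} (hx : pushforward φ x = x) : x X ≤ 1 :=
    le_one_of_pushforward_eq_self hna hd' hcoeff hlead hx
  have hev0 : evPoint (0 : L) X ≤ 1 := by simp
  set ζ := thicken hna (evPoint (0 : L)) 1 with hζ
  have hζmem : pushforward φ ζ = ζ := by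
    rw [pushforward_eq_self_iff]
    intro b
    rw [hζ, thicken_one_X_sub_C hna hev0, thicken_sub_C hna _ le_rfl
      (fun i _ => apply_le_one hna hev0 (norm_coeff_hasseDeriv_le_one hna hcoeff i))
      ⟨φ.natDegree, by omega, by simp [hasseDeriv_natDegree_eq_C, hlead]⟩, NNReal.coe_one]
    exact max_apply_sub_C_one hna (apply_le_one hna hev0 hcoeff) b
  constructor
  · rintro hconn ⟨c, hc, hfix, hcrit⟩
    obtain ⟨a, ha, hca⟩ : ∃ a : L, (φ - X).eval a = 0 ∧ ‖c - a‖ < 1 := by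
      refine exists_root_of_norm_eval_lt_one (P := φ - X) ?_ (by simpa using hfix)
      rwa [leadingCoeff_sub_of_degree_lt]
      exact degree_lt_degree (by rw [natDegree_X]; omega)
    replace ha : φ.eval a = a := by simpa [sub_eq_zero] using ha
    have ha1 : ‖a‖ ≤ 1 := by
      have := hna c (-(c - a))
      rw [← sub_eq_add_neg, sub_sub_cancel] at this
      exact this.trans (max_le hc ((norm_neg _).trans_le hca.le))
    have hdcoeff : ∀ i, ‖(derivative φ).coeff i‖ ≤ 1 := by
      rw [← hasseDeriv_one']
      exact norm_coeff_hasseDeriv_le_one hna hcoeff 1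
    have hda : ‖(derivative φ).eval a‖ < 1 := by
      have h1 := apply_sub_C_eval_le hna (x := evPoint a) (by simpa using ha1) hdcoeff hc
      simp only [evPoint_apply, eval_sub, eval_C, eval_X] at h1
      rw [norm_sub_rev a c] at h1
      have h2 := hna ((derivative φ).eval a - (derivative φ).eval c) ((derivative φ).eval c)
      rw [sub_add_cancel] at h2
      exact h2.trans_lt (max_lt (h1.trans_lt hca) hcrit)
    obtain ⟨Q, hQ, hφQ⟩ := exists_sub_C_eval_eq_mul hna hcoeff ha1
    have hQa : Q.eval a = (derivative φ).eval a := by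
      have := congrArg (fun P => (derivative P).eval a) hφQ
      simpa using this.symm
    have hevmem : pushforward φ (evPoint a) = evPoint a := by
      rw [pushforward_eq_self_iff]
      intro b
      simp [ha]
    have hζa : ζ (X - C a) = 1 := by
      rw [hζ, thicken_one_X_sub_C hna hev0]
      exact max_eq_right ha1
    -- the distance to the attracting fixed point takes no value strictly between zero and one
    obtain ⟨x, hx, hxa⟩ := hconn.isPreconnected.intermediate_value hevmem hζmem
      (continuous_apply_const (X - C a)).continuousOn
      (show (1 / 2 : ℝ) ∈ Set.Icc _ _ by rw [hζa]; simp; norm_num)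
    have hx1 := hle hx
    dsimp only at hxa
    have h1 := pushforward_eq_self_iff.1 hx a
    rw [← ha, hφQ, map_mul, ha, hxa] at h1
    have h2 := x.isNonarchimedean hna (Q - C (Q.eval a)) (C (Q.eval a))
    rw [sub_add_cancel, apply_C, hQa] at h2
    have h3 := apply_sub_C_eval_le hna hx1 hQ ha1
    rw [hxa, hQa] at h3
    have h4 : x Q < 1 := h2.trans_lt (max_lt (h3.trans_lt (by norm_num)) hda)
    linarith
  · intro hcrit
    refine IsPathConnected.isConnected ⟨ζ, hζmem, fun {x} hx => JoinedIn.symm ?_⟩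
    have hx1 := hle hx
    by_cases hc : ∃ c : L, ‖c‖ ≤ 1 ∧ x (X - C c) < 1
    · obtain ⟨c, hc, hxc⟩ := hc
      have hφc := (apply_sub_C_eval_le hna hx1 hcoeff hc).trans_lt hxc
      have hfix : ‖φ.eval c - c‖ < 1 := by
        have h := x.isNonarchimedean hna (φ - C c) (-(φ - C (φ.eval c)))
        rw [map_neg_eq_map, pushforward_eq_self_iff.1 hx c, ← sub_eq_add_neg,
          sub_sub_sub_cancel_left, ← C_sub, apply_C] at h
        exact h.trans_lt (max_lt hxc hφc)
      have hdcoeff := norm_coeff_hasseDeriv_le_one hna hcoeff 1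
      have hdc : 1 ≤ ‖(hasseDeriv 1 φ).eval c‖ := by
        rw [hasseDeriv_one']
        by_contra! h
        exact hcrit ⟨c, hc, hfix, h⟩
      have hxd : x (hasseDeriv 1 φ) = 1 := by
        refine le_antisymm (apply_le_one hna hx1 hdcoeff) ?_
        by_contra! h
        have h1 := apply_sub_C_eval_le hna hx1 hdcoeff hc
        have h2 := x.isNonarchimedean hna (hasseDeriv 1 φ)
          (-(hasseDeriv 1 φ - C ((hasseDeriv 1 φ).eval c)))
        rw [map_neg_eq_map, ← sub_eq_add_neg, sub_sub_cancel, apply_C] at h2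
        exact (h2.trans_lt (max_lt h (h1.trans_lt hxc))).not_ge hdc
      refine JoinedIn.ofLine (f := fun t : ℝ => thicken hna x t.toNNReal)
        ((continuous_thicken hna x).comp continuous_real_toNNReal).continuousOn ?_ ?_ ?_
      · simp [thicken_zero]
      · simpa using thicken_one_eq hna hx1 hev0
      · rintro _ ⟨t, ht, rfl⟩
        exact pushforward_thicken_eq_self hna hcoeff hx1 hx (Real.toNNReal_le_one.2 ht.2)
          ⟨1, one_ne_zero, by rw [hxd, pow_one, one_mul]⟩
    · push Not at hc
      have : x = ζ := by
        refine ext_of_X_sub_C fun b => ?_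
        have hb := max_apply_sub_C_one hna hx1 b
        rw [hζ, thicken_one_X_sub_C hna hev0, ← hb]
        refine (max_eq_left ?_).symm
        rcases le_or_gt ‖b‖ 1 with h | h
        · exact hc b h
        · rw [max_eq_left h.le] at hb
          by_contra! h'
          rw [max_eq_right h'.le] at hb
          exact h.ne hb
      rw [this]
      exact JoinedIn.refl hζmem
end
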